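/- In the doubled frame setting, let d : U → ℝ be smooth and strictly positive on an open set U ⊆ ℝⁿ×ℝⁿ and satisfy the eikonal hypotheses, and let α ∈ ℝ. Then at every point of U: ⟨((D_𝔷²(d^α))*)² · D_𝔷d, D_𝔷d⟩ = α² d^{2α−2} ⟨((D_𝔷²d)*)² · D_𝔷d, D_𝔷d⟩ + 8α²(α−1)² d^{2α−4}. Consequently, if c₀ ≥ 0 is a constant with ⟨((D_𝔷²d)*)² · D_𝔷d, D_𝔷d⟩ ≤ c₀ on U, then 0 ≤ ⟨((D_𝔷²(d^α))*)² · D_𝔷d, D_𝔷d⟩ ≤ c₀ α² d^{2α−2} + 8α²(α−1)² d^{2α−4} on U. -/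

import Mathlib

open Matrix

noncomputable section

/-- Doubled frame on `ℝⁿ × ℝⁿ`: `Z (inl i) (x,y) = (Xᵢ(x), 0)` and
`Z (inr i) (x,y) = (0, Xᵢ(y))`. -/
def Zf {n : ℕ} (X : Fin n → (Fin n → ℝ) → (Fin n → ℝ)) :
    (Fin n ⊕ Fin n) → (Fin n → ℝ) × (Fin n → ℝ) → (Fin n → ℝ) × (Fin n → ℝ)
  | Sum.inl i, p => (X i p.1, 0)
  | Sum.inr i, p => (0, X i p.2)

/-- Frame gradient `D_𝔷 d` of `d` at `p`, as a vector in `ℝ²ⁿ`. -/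
def Dz {n : ℕ} (X : Fin n → (Fin n → ℝ) → (Fin n → ℝ))
    (d : (Fin n → ℝ) × (Fin n → ℝ) → ℝ) (p : (Fin n → ℝ) × (Fin n → ℝ)) :
    (Fin n ⊕ Fin n) → ℝ :=
  fun i => fderiv ℝ d p (Zf X i p)

/-- Frame second derivative `D²_𝔷 d` of `d` at `p`: the `2n × 2n` matrix with
`(i,j)`-entry `Zᵢ(Zⱼd)(p)`. -/
def Dz2 {n : ℕ} (X : Fin n → (Fin n → ℝ) → (Fin n → ℝ))
    (d : (Fin n → ℝ) × (Fin n → ℝ) → ℝ) (p : (Fin n → ℝ) × (Fin n → ℝ)) :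
    Matrix (Fin n ⊕ Fin n) (Fin n ⊕ Fin n) ℝ :=
  fun i j => fderiv ℝ (fun q => fderiv ℝ d q (Zf X j q)) p (Zf X i p)

/-- Symmetrized frame second derivative `(D²_𝔷 d)* = ½(D²_𝔷 d + (D²_𝔷 d)ᵗ)`. -/
def Dz2Sym {n : ℕ} (X : Fin n → (Fin n → ℝ) → (Fin n → ℝ))
    (d : (Fin n → ℝ) × (Fin n → ℝ) → ℝ) (p : (Fin n → ℝ) × (Fin n → ℝ)) :
    Matrix (Fin n ⊕ Fin n) (Fin n ⊕ Fin n) ℝ :=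
  (1 / 2 : ℝ) • (Dz2 X d p + (Dz2 X d p)ᵀ)

/-- The eikonal hypotheses: `Σᵢ₌₁ⁿ (Zᵢd)² = 1` and `Σᵢ₌ₙ₊₁²ⁿ (Zᵢd)² = 1` on `U`. -/
def EikonalHyp {n : ℕ} (X : Fin n → (Fin n → ℝ) → (Fin n → ℝ))
    (d : (Fin n → ℝ) × (Fin n → ℝ) → ℝ)
    (U : Set ((Fin n → ℝ) × (Fin n → ℝ))) : Prop :=
  ∀ p ∈ U, (∑ i : Fin n, (Dz X d p (Sum.inl i)) ^ 2 = 1) ∧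
    (∑ i : Fin n, (Dz X d p (Sum.inr i)) ^ 2 = 1)

theorem mulVec_sq_dotProduct_self {ι : Type*} [Fintype ι] {S : Matrix ι ι ℝ} (hS : Sᵀ = S)
    (v : ι → ℝ) : (S * S) *ᵥ v ⬝ᵥ v = S *ᵥ v ⬝ᵥ S *ᵥ v := by
  rw [← mulVec_mulVec, dotProduct_comm, dotProduct_mulVec, ← mulVec_transpose, hS]

theorem rankOne_update_sq_dotProduct_self {ι : Type*} [Fintype ι] {S : Matrix ι ι ℝ}
    (hS : Sᵀ = S) {w : ι → ℝ} {s : ℝ} (hw : w ⬝ᵥ w = s) (hSw : S *ᵥ w ⬝ᵥ w = 0) (a b : ℝ) :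
    ((a • S + b • vecMulVec w w) * (a • S + b • vecMulVec w w)) *ᵥ w ⬝ᵥ w
      = a ^ 2 * ((S * S) *ᵥ w ⬝ᵥ w) + b ^ 2 * s ^ 3 := by
  have hA : (a • S + b • vecMulVec w w)ᵀ = a • S + b • vecMulVec w w := by
    simp [hS, transpose_vecMulVec]
  have hAw : (a • S + b • vecMulVec w w) *ᵥ w = a • (S *ᵥ w) + (b * s) • w := by
    rw [add_mulVec, smul_mulVec, smul_mulVec, vecMulVec_mulVec, hw, op_smul_eq_smul, smul_smul]
  rw [mulVec_sq_dotProduct_self hA, mulVec_sq_dotProduct_self hS, hAw]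
  have hwS : w ⬝ᵥ S *ᵥ w = 0 := by rw [dotProduct_comm, hSw]
  simp only [add_dotProduct, dotProduct_add, smul_dotProduct, dotProduct_smul, hw, hSw, hwS,
    smul_eq_mul]
  ring

theorem differentiable_Zf {n : ℕ} {X : Fin n → (Fin n → ℝ) → (Fin n → ℝ)}
    (hX : ∀ i, Differentiable ℝ (X i)) (j : Fin n ⊕ Fin n) : Differentiable ℝ (Zf X j) := by
  cases j with
  | inl i => exact ((hX i).comp differentiable_fst).prodMk (differentiable_const 0)
  | inr i => exact (differentiable_const 0).prodMk ((hX i).comp differentiable_snd)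

theorem differentiableAt_Dz {n : ℕ} {X : Fin n → (Fin n → ℝ) → (Fin n → ℝ)}
    (hX : ∀ i, Differentiable ℝ (X i)) {d : (Fin n → ℝ) × (Fin n → ℝ) → ℝ}
    {p : (Fin n → ℝ) × (Fin n → ℝ)} (hd : ContDiffAt ℝ 2 d p) (j : Fin n ⊕ Fin n) :
    DifferentiableAt ℝ (fun q => fderiv ℝ d q (Zf X j q)) p :=
  ((hd.fderiv_right (m := 1) (by norm_num)).differentiableAt one_ne_zero).clm_apply
    (differentiable_Zf hX j p)

theorem Dz2_rpow {n : ℕ} {X : Fin n → (Fin n → ℝ) → (Fin n → ℝ)}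
    (hX : ∀ i, Differentiable ℝ (X i)) {d : (Fin n → ℝ) × (Fin n → ℝ) → ℝ}
    {p : (Fin n → ℝ) × (Fin n → ℝ)} (hd : ContDiffAt ℝ 2 d p) (hp : 0 < d p) (α : ℝ) :
    Dz2 X (fun q => d q ^ α) p = (α * d p ^ (α - 1)) • Dz2 X d p
      + (α * (α - 1) * d p ^ (α - 2)) • vecMulVec (Dz X d p) (Dz X d p) := by
  ext i j
  have hev : (fun q => fderiv ℝ (fun q => d q ^ α) q (Zf X j q)) =ᶠ[nhds p]
      fun q => (α * d q ^ (α - 1)) * fderiv ℝ d q (Zf X j q) := by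
    filter_upwards [hd.eventually (by simp), hd.continuousAt.eventually (lt_mem_nhds hp)]
      with q hq hq0
    rw [((hq.differentiableAt two_ne_zero).hasFDerivAt.rpow_const (Or.inl hq0.ne')).fderiv]
    simp
  have hpow := ((hd.differentiableAt two_ne_zero).hasFDerivAt.rpow_const (p := α - 1)
    (Or.inl hp.ne')).const_mul α
  have hmul := hpow.fun_mul (differentiableAt_Dz hX hd j).hasFDerivAt
  have he : α - 1 - 1 = α - 2 := by ring
  simp only [Dz2, Matrix.add_apply, Matrix.smul_apply, vecMulVec_apply, Dz, hev.fderiv_eq,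
    hmul.fderiv, _root_.add_apply, _root_.smul_apply, smul_eq_mul, he]
  ring

theorem Dz2Sym_rpow {n : ℕ} {X : Fin n → (Fin n → ℝ) → (Fin n → ℝ)}
    (hX : ∀ i, Differentiable ℝ (X i)) {d : (Fin n → ℝ) × (Fin n → ℝ) → ℝ}
    {p : (Fin n → ℝ) × (Fin n → ℝ)} (hd : ContDiffAt ℝ 2 d p) (hp : 0 < d p) (α : ℝ) :
    Dz2Sym X (fun q => d q ^ α) p = (α * d p ^ (α - 1)) • Dz2Sym X d p
      + (α * (α - 1) * d p ^ (α - 2)) • vecMulVec (Dz X d p) (Dz X d p) := by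
  ext i j
  simp only [Dz2Sym, Dz2_rpow hX hd hp, Matrix.smul_apply, Matrix.add_apply, transpose_apply, smul_eq_mul,
    vecMulVec_apply]
  ring

theorem transpose_Dz2Sym {n : ℕ} (X : Fin n → (Fin n → ℝ) → (Fin n → ℝ))
    (d : (Fin n → ℝ) × (Fin n → ℝ) → ℝ) (p : (Fin n → ℝ) × (Fin n → ℝ)) :
    (Dz2Sym X d p)ᵀ = Dz2Sym X d p := by
  simp [Dz2Sym, add_comm]

theorem EikonalHyp.dotProduct_Dz_self {n : ℕ} {X : Fin n → (Fin n → ℝ) → (Fin n → ℝ)}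
    {d : (Fin n → ℝ) × (Fin n → ℝ) → ℝ} {U : Set ((Fin n → ℝ) × (Fin n → ℝ))}
    (h : EikonalHyp X d U) {p : (Fin n → ℝ) × (Fin n → ℝ)} (hp : p ∈ U) :
    Dz X d p ⬝ᵥ Dz X d p = 2 := by
  obtain ⟨h₁, h₂⟩ := h p hp
  simp only [dotProduct, Fintype.sum_sum_type, ← sq, h₁, h₂]
  norm_num

theorem EikonalHyp.Dz2_mulVec_Dz {n : ℕ} {X : Fin n → (Fin n → ℝ) → (Fin n → ℝ)}
    (hX : ∀ i, Differentiable ℝ (X i))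
    {d : (Fin n → ℝ) × (Fin n → ℝ) → ℝ} {U : Set ((Fin n → ℝ) × (Fin n → ℝ))} (hU : IsOpen U)
    (h : EikonalHyp X d U) {p : (Fin n → ℝ) × (Fin n → ℝ)} (hp : p ∈ U)
    (hd : ContDiffAt ℝ 2 d p) : Dz2 X d p *ᵥ Dz X d p = 0 := by
  have hconst : (fun q => ∑ j, Dz X d q j ^ 2) =ᶠ[nhds p] fun _ => 2 := by
    filter_upwards [hU.mem_nhds hp] with q hq
    simpa only [dotProduct, ← sq] using h.dotProduct_Dz_self hq
  have hsum : HasFDerivAt (fun q => ∑ j, Dz X d q j ^ 2) _ p :=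
    HasFDerivAt.fun_sum fun j _ => (differentiableAt_Dz hX hd j).hasFDerivAt.pow 2
  have hzero := hsum.unique ((hasFDerivAt_const (2 : ℝ) p).congr_of_eventuallyEq hconst)
  ext i
  have hi := DFunLike.congr_fun hzero (Zf X i p)
  simp only [_root_.sum_apply, _root_.smul_apply, _root_.zero_apply, smul_eq_mul] at hi
  simp only [mulVec, dotProduct, Dz2, Dz, Pi.zero_apply]
  norm_num [mul_assoc, ← Finset.mul_sum, -Fintype.sum_sum_type] at hi
  simpa only [mul_comm] using hi

theorem EikonalHyp.Dz2Sym_mulVec_Dz_dotProduct_Dz {n : ℕ}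
    {X : Fin n → (Fin n → ℝ) → (Fin n → ℝ)} (hX : ∀ i, Differentiable ℝ (X i))
    {d : (Fin n → ℝ) × (Fin n → ℝ) → ℝ} {U : Set ((Fin n → ℝ) × (Fin n → ℝ))} (hU : IsOpen U)
    (h : EikonalHyp X d U) {p : (Fin n → ℝ) × (Fin n → ℝ)} (hp : p ∈ U)
    (hd : ContDiffAt ℝ 2 d p) : Dz2Sym X d p *ᵥ Dz X d p ⬝ᵥ Dz X d p = 0 := by
  rw [Dz2Sym, smul_mulVec, add_mulVec, h.Dz2_mulVec_Dz hX hU hp hd, zero_add, mulVec_transpose,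
    smul_dotProduct, ← dotProduct_mulVec, h.Dz2_mulVec_Dz hX hU hp hd, dotProduct_zero, smul_zero]

/-- In the doubled frame setting, if `d` is smooth and strictly positive on an
open `U ⊆ ℝⁿ×ℝⁿ` and satisfies the eikonal hypotheses, then for any `α ∈ ℝ`, at every
point of `U`,
`⟨((D²_𝔷(d^α))*)² · D_𝔷d, D_𝔷d⟩ = α² d^(2α−2) ⟨((D²_𝔷d)*)² · D_𝔷d, D_𝔷d⟩ + 8α²(α−1)² d^(2α−4)`;
consequently, if `⟨((D²_𝔷d)*)² · D_𝔷d, D_𝔷d⟩ ≤ c₀` on `U` for a constant `c₀ ≥ 0`, then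
`0 ≤ ⟨((D²_𝔷(d^α))*)² · D_𝔷d, D_𝔷d⟩ ≤ c₀ α² d^(2α−2) + 8α²(α−1)² d^(2α−4)` on `U`. -/
theorem stmt10 {n : ℕ} (X : Fin n → (Fin n → ℝ) → (Fin n → ℝ))
    (hX : ∀ i, ContDiff ℝ (⊤ : ℕ∞) (X i))
    (U : Set ((Fin n → ℝ) × (Fin n → ℝ))) (hU : IsOpen U)
    (d : (Fin n → ℝ) × (Fin n → ℝ) → ℝ) (hd : ContDiffOn ℝ (⊤ : ℕ∞) d U)
    (hdpos : ∀ p ∈ U, 0 < d p)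
    (heik : EikonalHyp X d U) (α : ℝ) :
    (∀ p ∈ U,
      (Dz2Sym X (fun q => d q ^ α) p * Dz2Sym X (fun q => d q ^ α) p).mulVec
          (Dz X d p) ⬝ᵥ Dz X d p
        = α ^ 2 * d p ^ (2 * α - 2) *
            ((Dz2Sym X d p * Dz2Sym X d p).mulVec (Dz X d p) ⬝ᵥ Dz X d p)
          + 8 * α ^ 2 * (α - 1) ^ 2 * d p ^ (2 * α - 4)) ∧
    (∀ c₀ : ℝ, 0 ≤ c₀ →
      (∀ p ∈ U, (Dz2Sym X d p * Dz2Sym X d p).mulVec (Dz X d p) ⬝ᵥ Dz X d p ≤ c₀) →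
      ∀ p ∈ U,
        0 ≤ (Dz2Sym X (fun q => d q ^ α) p * Dz2Sym X (fun q => d q ^ α) p).mulVec
              (Dz X d p) ⬝ᵥ Dz X d p ∧
        (Dz2Sym X (fun q => d q ^ α) p * Dz2Sym X (fun q => d q ^ α) p).mulVec
              (Dz X d p) ⬝ᵥ Dz X d p
          ≤ c₀ * α ^ 2 * d p ^ (2 * α - 2) + 8 * α ^ 2 * (α - 1) ^ 2 * d p ^ (2 * α - 4)) := by
  have hX' : ∀ i, Differentiable ℝ (X i) := fun i => (hX i).differentiable (by simp)
  have key : ∀ p ∈ U,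
      (Dz2Sym X (fun q => d q ^ α) p * Dz2Sym X (fun q => d q ^ α) p).mulVec
          (Dz X d p) ⬝ᵥ Dz X d p
        = α ^ 2 * d p ^ (2 * α - 2) *
            ((Dz2Sym X d p * Dz2Sym X d p).mulVec (Dz X d p) ⬝ᵥ Dz X d p)
          + 8 * α ^ 2 * (α - 1) ^ 2 * d p ^ (2 * α - 4) := by
    intro p hp
    have hdp : ContDiffAt ℝ 2 d p :=
      (hd.contDiffAt (hU.mem_nhds hp)).of_le (WithTop.coe_le_coe.2 le_top)
    have hpow : ∀ x : ℝ, (d p ^ x) ^ 2 = d p ^ (2 * x) := fun x => by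
      rw [mul_comm, Real.rpow_mul (hdpos p hp).le, Real.rpow_two]
    rw [Dz2Sym_rpow hX' hdp (hdpos p hp), rankOne_update_sq_dotProduct_self
      (transpose_Dz2Sym X d p) (heik.dotProduct_Dz_self hp)
      (heik.Dz2Sym_mulVec_Dz_dotProduct_Dz hX' hU hp hdp), mul_pow, mul_pow, mul_pow, hpow, hpow,
      show 2 * (α - 1) = 2 * α - 2 by ring, show 2 * (α - 2) = 2 * α - 4 by ring]
    ring
  refine ⟨key, fun c₀ _ hc p hp => ⟨?_, ?_⟩⟩
  · rw [mulVec_sq_dotProduct_self (transpose_Dz2Sym X _ p)]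
    exact Finset.sum_nonneg fun i _ => mul_self_nonneg _
  · rw [key p hp]
    have hpos : 0 ≤ α ^ 2 * d p ^ (2 * α - 2) :=
      mul_nonneg (sq_nonneg α) (Real.rpow_nonneg (hdpos p hp).le _)
    linarith [mul_le_mul_of_nonneg_left (hc p hp) hpos]
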